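/- Let a20, a11, a02, a10, a01, a00 and a20', a11', a02', a10', a01', a00' and g be smooth real functions on ℝ², and define L u = ∂_x∂_x∂_y u + ∂_x∂_y∂_y u + a20·∂_x∂_x u + a11·∂_x∂_y u + a02·∂_y∂_y u + a10·∂_x u + a01·∂_y u + a00·u, and L' analogously with the primed coefficients. Set q = a20, p = a02, r = a11 − a20 − a02, and I₁₀ = a10 − (q·(p + r) + ∂_x q + ∂_y r), I₀₁ = a01 − (p·(q + r) + ∂_x q + ∂_x r), with I₁₀', I₀₁' defined by the same formulas from the primed coefficients. If L' u = e^{−g}·L(e^{g}·u) for every smooth u : ℝ² → ℝ, then I₁₀' = I₁₀ and I₀₁' = I₀₁. -/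

import Mathlib

noncomputable def dx (f : (Fin 2 → ℝ) → ℝ) : (Fin 2 → ℝ) → ℝ :=
  fun p => fderiv ℝ f p (Pi.single 0 1)

noncomputable def dy (f : (Fin 2 → ℝ) → ℝ) : (Fin 2 → ℝ) → ℝ :=
  fun p => fderiv ℝ f p (Pi.single 1 1)

lemma contDiff_dx {f : (Fin 2 → ℝ) → ℝ} (hf : ContDiff ℝ (⊤ : ℕ∞) f) :
    ContDiff ℝ (⊤ : ℕ∞) (dx f) :=
  (hf.fderiv_right (m := (⊤ : ℕ∞)) (by simp)).clm_apply contDiff_const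

lemma contDiff_dy {f : (Fin 2 → ℝ) → ℝ} (hf : ContDiff ℝ (⊤ : ℕ∞) f) :
    ContDiff ℝ (⊤ : ℕ∞) (dy f) :=
  (hf.fderiv_right (m := (⊤ : ℕ∞)) (by simp)).clm_apply contDiff_const

lemma ContDiff.differentiable_of_smooth {f : (Fin 2 → ℝ) → ℝ}
    (hf : ContDiff ℝ (⊤ : ℕ∞) f) : Differentiable ℝ f :=
  hf.differentiable (by simp)

/-- Mixed partial derivatives of a smooth function commute. -/
lemma dy_dx_comm {f : (Fin 2 → ℝ) → ℝ} (hf : ContDiff ℝ (⊤ : ℕ∞) f) :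
    dy (dx f) = dx (dy f) := by
  funext x
  have hd : DifferentiableAt ℝ (fderiv ℝ f) x :=
    (hf.fderiv_right (m := (⊤ : ℕ∞)) (by simp)).differentiable (by simp) x
  have hs : IsSymmSndFDerivAt ℝ f x := hf.contDiffAt.isSymmSndFDerivAt
    (by simpa using WithTop.coe_le_coe.2 (le_top : (2 : ℕ∞) ≤ ⊤))
  have h := hs (Pi.single 1 1) (Pi.single 0 1)
  unfold dx dy
  rw [fderiv_clm_apply hd (differentiableAt_const _), fderiv_clm_apply hd (differentiableAt_const _)]
  simpa using h

lemma dx_add {f h : (Fin 2 → ℝ) → ℝ} (hf : ContDiff ℝ (⊤ : ℕ∞) f)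
    (hh : ContDiff ℝ (⊤ : ℕ∞) h) :
    dx (fun y => f y + h y) = fun y => dx f y + dx h y := by
  funext x
  simp [dx, fderiv_fun_add (hf.differentiable_of_smooth x) (hh.differentiable_of_smooth x)]

lemma dx_mul {f h : (Fin 2 → ℝ) → ℝ} (hf : ContDiff ℝ (⊤ : ℕ∞) f)
    (hh : ContDiff ℝ (⊤ : ℕ∞) h) :
    dx (fun y => f y * h y) = fun y => f y * dx h y + dx f y * h y := by
  funext x
  simp [dx, fderiv_fun_mul (hf.differentiable_of_smooth x) (hh.differentiable_of_smooth x),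
    mul_comm]

lemma dx_exp_mul {g w : (Fin 2 → ℝ) → ℝ} (hg : ContDiff ℝ (⊤ : ℕ∞) g)
    (hw : ContDiff ℝ (⊤ : ℕ∞) w) :
    dx (fun y => Real.exp (g y) * w y) =
      fun y => Real.exp (g y) * (dx w y + dx g y * w y) := by
  rw [dx_mul hg.exp hw]
  funext x
  have h : dx (fun y => Real.exp (g y)) x = Real.exp (g x) * dx g x := by
    simp [dx, fderiv_exp (hg.differentiable_of_smooth x)]
  rw [h]
  ring

lemma dy_add {f h : (Fin 2 → ℝ) → ℝ} (hf : ContDiff ℝ (⊤ : ℕ∞) f)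
    (hh : ContDiff ℝ (⊤ : ℕ∞) h) :
    dy (fun y => f y + h y) = fun y => dy f y + dy h y := by
  funext x
  simp [dy, fderiv_fun_add (hf.differentiable_of_smooth x) (hh.differentiable_of_smooth x)]

lemma dy_mul {f h : (Fin 2 → ℝ) → ℝ} (hf : ContDiff ℝ (⊤ : ℕ∞) f)
    (hh : ContDiff ℝ (⊤ : ℕ∞) h) :
    dy (fun y => f y * h y) = fun y => f y * dy h y + dy f y * h y := by
  funext x
  simp [dy, fderiv_fun_mul (hf.differentiable_of_smooth x) (hh.differentiable_of_smooth x),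
    mul_comm]

lemma dy_exp_mul {g w : (Fin 2 → ℝ) → ℝ} (hg : ContDiff ℝ (⊤ : ℕ∞) g)
    (hw : ContDiff ℝ (⊤ : ℕ∞) w) :
    dy (fun y => Real.exp (g y) * w y) =
      fun y => Real.exp (g y) * (dy w y + dy g y * w y) := by
  rw [dy_mul hg.exp hw]
  funext x
  have h : dy (fun y => Real.exp (g y)) x = Real.exp (g x) * dy g x := by
    simp [dy, fderiv_exp (hg.differentiable_of_smooth x)]
  rw [h]
  ring

/-- The quadratic polynomial with given Taylor coefficients at the point `c`. -/
def quadraticAt (c : Fin 2 → ℝ) (k a b α β γ : ℝ) : (Fin 2 → ℝ) → ℝ := fun y =>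
  k + a * (y 0 - c 0) + b * (y 1 - c 1) + α * (y 0 - c 0) ^ 2
    + β * ((y 0 - c 0) * (y 1 - c 1)) + γ * (y 1 - c 1) ^ 2

lemma contDiff_quadraticAt (c : Fin 2 → ℝ) (k a b α β γ : ℝ) :
    ContDiff ℝ (⊤ : ℕ∞) (quadraticAt c k a b α β γ) := by
  unfold quadraticAt
  fun_prop

lemma quadraticAt_self (c : Fin 2 → ℝ) (k a b α β γ : ℝ) :
    quadraticAt c k a b α β γ c = k := by
  simp [quadraticAt]

lemma hasFDerivAt_quadraticAt (c : Fin 2 → ℝ) (k a b α β γ : ℝ) (x : Fin 2 → ℝ) :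
    HasFDerivAt (quadraticAt c k a b α β γ)
      ((a + 2 * α * (x 0 - c 0) + β * (x 1 - c 1)) •
          ContinuousLinearMap.proj (R := ℝ) (φ := fun _ : Fin 2 => ℝ) 0
        + (b + β * (x 0 - c 0) + 2 * γ * (x 1 - c 1)) •
          ContinuousLinearMap.proj (R := ℝ) (φ := fun _ : Fin 2 => ℝ) 1) x := by
  have h0 := (hasFDerivAt_apply (𝕜 := ℝ) (F' := fun _ : Fin 2 => ℝ) 0 x).sub_const (c 0)
  have h1 := (hasFDerivAt_apply (𝕜 := ℝ) (F' := fun _ : Fin 2 => ℝ) 1 x).sub_const (c 1)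
  refine ((((((hasFDerivAt_const k x).add (h0.const_mul a)).add (h1.const_mul b)).add
    ((h0.pow 2).const_mul α)).add ((h0.mul h1).const_mul β)).add
    ((h1.pow 2).const_mul γ)).congr_fderiv ?_
  ext v
  simp
  ring

lemma dx_quadraticAt (c : Fin 2 → ℝ) (k a b α β γ : ℝ) :
    dx (quadraticAt c k a b α β γ) = quadraticAt c a (2 * α) β 0 0 0 := by
  funext x
  simp [dx, (hasFDerivAt_quadraticAt c k a b α β γ x).fderiv, quadraticAt]

lemma dy_quadraticAt (c : Fin 2 → ℝ) (k a b α β γ : ℝ) :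
    dy (quadraticAt c k a b α β γ) = quadraticAt c b β (2 * γ) 0 0 0 := by
  funext x
  simp [dy, (hasFDerivAt_quadraticAt c k a b α β γ x).fderiv, quadraticAt]

theorem laplace_invariants_xxy_xyy
    (a20 a11 a02 a10 a01 a00 a20' a11' a02' a10' a01' a00' g : (Fin 2 → ℝ) → ℝ)
    (h20 : ContDiff ℝ (⊤ : ℕ∞) a20) (h11 : ContDiff ℝ (⊤ : ℕ∞) a11) (h02 : ContDiff ℝ (⊤ : ℕ∞) a02)
    (h10 : ContDiff ℝ (⊤ : ℕ∞) a10) (h01 : ContDiff ℝ (⊤ : ℕ∞) a01) (h00 : ContDiff ℝ (⊤ : ℕ∞) a00)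
    (h20' : ContDiff ℝ (⊤ : ℕ∞) a20') (h11' : ContDiff ℝ (⊤ : ℕ∞) a11') (h02' : ContDiff ℝ (⊤ : ℕ∞) a02')
    (h10' : ContDiff ℝ (⊤ : ℕ∞) a10') (h01' : ContDiff ℝ (⊤ : ℕ∞) a01') (h00' : ContDiff ℝ (⊤ : ℕ∞) a00')
    (hg : ContDiff ℝ (⊤ : ℕ∞) g)
    (hgauge : ∀ u : (Fin 2 → ℝ) → ℝ, ContDiff ℝ (⊤ : ℕ∞) u → ∀ x,
      dx (dx (dy u)) x + dx (dy (dy u)) x + a20' x * dx (dx u) x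
        + a11' x * dx (dy u) x + a02' x * dy (dy u) x
        + a10' x * dx u x + a01' x * dy u x + a00' x * u x =
      Real.exp (-(g x)) *
        (dx (dx (dy (fun y => Real.exp (g y) * u y))) x
          + dx (dy (dy (fun y => Real.exp (g y) * u y))) x
          + a20 x * dx (dx (fun y => Real.exp (g y) * u y)) x
          + a11 x * dx (dy (fun y => Real.exp (g y) * u y)) x
          + a02 x * dy (dy (fun y => Real.exp (g y) * u y)) x
          + a10 x * dx (fun y => Real.exp (g y) * u y) x
          + a01 x * dy (fun y => Real.exp (g y) * u y) x
          + a00 x * (Real.exp (g x) * u x))) :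
    (∀ x,
      (let q := a20'; let p := a02'; let r := fun y => a11' y - a20' y - a02' y
       a10' x - (q x * (p x + r x) + dx q x + dy r x)) =
      (let q := a20; let p := a02; let r := fun y => a11 y - a20 y - a02 y
       a10 x - (q x * (p x + r x) + dx q x + dy r x))) ∧
    (∀ x,
      (let q := a20'; let p := a02'; let r := fun y => a11' y - a20' y - a02' y
       a01' x - (p x * (q x + r x) + dx q x + dx r x)) =
      (let q := a20; let p := a02; let r := fun y => a11 y - a20 y - a02 y
       a01 x - (p x * (q x + r x) + dx q x + dx r x))) := by
  have key : ∀ (x : Fin 2 → ℝ) (a b α β γ : ℝ),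
      2 * α * a20' x + β * a11' x + 2 * γ * a02' x + a * a10' x + b * a01' x =
        2 * α * (a20 x + dy g x) + β * (a11 x + 2 * dx g x + 2 * dy g x)
        + 2 * γ * (a02 x + dx g x)
        + a * (a10 x + 2 * a20 x * dx g x + a11 x * dy g x + 2 * dx (dy g) x
          + 2 * dx g x * dy g x + dy (dy g) x + dy g x ^ 2)
        + b * (a01 x + 2 * a02 x * dy g x + a11 x * dx g x + 2 * dx (dy g) x
          + 2 * dx g x * dy g x + dx (dx g) x + dx g x ^ 2) := by
    intro x a b α β γ
    have hu := contDiff_quadraticAt x 0 a b α β γ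
    have h := hgauge _ hu x
    have hgx := contDiff_dx hg
    have hgy := contDiff_dy hg
    have hux := contDiff_dx hu
    have huy := contDiff_dy hu
    have e1 := dx_exp_mul hg hu
    have e2 := dy_exp_mul hg hu
    have hv := hux.add (hgx.mul hu)
    have hw := huy.add (hgy.mul hu)
    have e11 := dx_exp_mul hg hv
    have e12 := dx_exp_mul hg hw
    have e22 := dy_exp_mul hg hw
    have e112 := dx_exp_mul hg ((contDiff_dx hw).add (hgx.mul hw))
    have e122 := dx_exp_mul hg ((contDiff_dy hw).add (hgy.mul hw))
    rw [e1, e2, e11, e12, e22, e112, e122] at h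
    have hgxy := contDiff_dx hgy
    have hgyy := contDiff_dy hgy
    have huxy := contDiff_dx huy
    have huyy := contDiff_dy huy
    have f1 := dx_add hux (hgx.mul hu)
    have f2 := dx_add huy (hgy.mul hu)
    have f3 := dy_add huy (hgy.mul hu)
    rw [dx_mul hgx hu] at f1
    rw [dx_mul hgy hu] at f2
    rw [dy_mul hgy hu] at f3
    beta_reduce at f1 f2 f3
    have f4 := dx_add (contDiff_dx hw) (hgx.mul hw)
    have f5 := dx_add (contDiff_dy hw) (hgy.mul hw)
    rw [dx_mul hgx hw, f2, dx_add huxy ((hgy.mul hux).add (hgxy.mul hu)),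
      dx_add (hgy.mul hux) (hgxy.mul hu), dx_mul hgy hux, dx_mul hgxy hu] at f4
    rw [dx_mul hgy hw, f2, f3, dx_add huyy ((hgy.mul huy).add (hgyy.mul hu)),
      dx_add (hgy.mul huy) (hgyy.mul hu), dx_mul hgy huy, dx_mul hgyy hu] at f5
    beta_reduce at h f4 f5
    rw [f2, f3, f4, f5, f1] at h
    simp only [dx_quadraticAt, dy_quadraticAt, quadraticAt_self] at h
    have he : Real.exp (-(g x)) * Real.exp (g x) = 1 := by
      rw [← Real.exp_add]
      simp
    linear_combination h + (
        2 * α * (a20 x + dy g x) + β * (a11 x + 2 * dx g x + 2 * dy g x)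
        + 2 * γ * (a02 x + dx g x)
        + a * (a10 x + 2 * a20 x * dx g x + a11 x * dy g x + 2 * dx (dy g) x
          + 2 * dx g x * dy g x + dy (dy g) x + dy g x ^ 2)
        + b * (a01 x + 2 * a02 x * dy g x + a11 x * dx g x + 2 * dx (dy g) x
          + 2 * dx g x * dy g x + dx (dx g) x + dx g x ^ 2)) * he
  have k20 : a20' = fun x => a20 x + dy g x := by
    funext x
    linear_combination (1 / 2) * key x 0 0 1 0 0
  have k11 : a11' = fun x => a11 x + (2 * dx g x + 2 * dy g x) := by
    funext x
    linear_combination key x 0 0 0 1 0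
  have k02 : a02' = fun x => a02 x + dx g x := by
    funext x
    linear_combination (1 / 2) * key x 0 0 0 0 1
  have hgx := contDiff_dx hg
  have hgy := contDiff_dy hg
  have kr : (fun y => a11' y - a20' y - a02' y) =
      fun y => (a11 y - a20 y - a02 y) + (dx g y + dy g y) := by
    funext x
    rw [k20, k11, k02]
    ring
  have hr := (h11.sub h20).sub h02
  have k10 := fun x => key x 1 0 0 0 0
  have k01 := fun x => key x 0 1 0 0 0
  constructor
  · intro x
    have h := k10 x
    simp only [kr, dy_add hr (hgx.add hgy), dy_add hgx hgy, dy_dx_comm hg]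
    simp only [k20, k02, k11, dx_add h20 hgy] at h ⊢
    linear_combination h
  · intro x
    have h := k01 x
    simp only [kr, dx_add hr (hgx.add hgy), dx_add hgx hgy]
    simp only [k20, k02, k11, dx_add h20 hgy] at h ⊢
    linear_combination h
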